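/- For all integers d ≥ 2 and k ≥ d+1, there exist a constant C = C(d,k) > 0 and an integer n₀ = n₀(d,k) such that for every integer n ≥ n₀ and every convex body K ⊆ ℝ^d of unit d-dimensional volume, the expected number of k-holes satisfies EH^K_{d,k}(n) ≥ C · n^d. -/

import Mathlib

open MeasureTheory Filter

noncomputable section

abbrev Euc (d : ℕ) : Type := EuclideanSpace ℝ (Fin d)

/-- A convex body: compact convex set with nonempty interior. -/
def IsConvexBody {d : ℕ} (K : Set (Euc d)) : Prop :=
  Convex ℝ K ∧ IsCompact K ∧ (interior K).Nonempty

/-- A set of points is in convex position if no point lies in the convex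
hull of the others. -/
def InConvexPosition {d : ℕ} (P : Set (Euc d)) : Prop :=
  ∀ p ∈ P, p ∉ convexHull ℝ (P \ {p})

/-- `H` is a `k`-hole in `S`. -/
def IsHole {d : ℕ} (k : ℕ) (S H : Finset (Euc d)) : Prop :=
  H ⊆ S ∧ H.card = k ∧ InConvexPosition (H : Set (Euc d)) ∧
    ∀ p ∈ S, p ∉ interior (convexHull ℝ (H : Set (Euc d)))

open Classical in
/-- The number of `k`-holes in the point set given by `x`. -/
noncomputable def holeCount (d k n : ℕ) (x : Fin n → Euc d) : ℕ :=
  ((Finset.image x Finset.univ).powerset.filter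
    (fun H => IsHole k (Finset.image x Finset.univ) H)).card

/-- The uniform probability distribution on `K`. -/
noncomputable def unif {d : ℕ} (K : Set (Euc d)) : Measure (Euc d) :=
  (volume K)⁻¹ • volume.restrict K

/-- The expected number of `k`-holes among `n` points drawn uniformly and
independently at random from `K`. -/
noncomputable def EH (d k : ℕ) (K : Set (Euc d)) (n : ℕ) : ℝ :=
  ∫ x : Fin n → Euc d, (holeCount d k n x : ℝ) ∂(Measure.pi fun _ : Fin n => unif K)

/-- The probability that, for `d+2` points chosen uniformly and independently
at random from `K`, one of the points lies in the convex hull of the others. -/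
noncomputable def pSimplex (d : ℕ) (K : Set (Euc d)) : ℝ :=
  ((Measure.pi fun _ : Fin (d + 2) => unif K)
    {x : Fin (d + 2) → Euc d | ∃ i, x i ∈ convexHull ℝ (x '' {j | j ≠ i})}).toReal

/-- The maximum of `pSimplex d K` over all convex bodies `K ⊆ ℝ^d`. -/
noncomputable def pMax (d : ℕ) : ℝ :=
  sSup {p : ℝ | ∃ K : Set (Euc d), IsConvexBody K ∧ p = pSimplex d K}

end

section Measurability

/-- The condition that a translate of one point of a tuple lies in the convex hull of other
points of the tuple is closed. -/
lemma isClosed_setOf_add_mem_convexHull {d n : ℕ} (j : Fin n) (q : Euc d) (J : Set (Fin n)) :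
    IsClosed {x : Fin n → Euc d | x j + q ∈ convexHull ℝ (x '' J)} := by
  classical
  have hset : {x : Fin n → Euc d | x j + q ∈ convexHull ℝ (x '' J)} =
      Prod.snd '' {p : stdSimplex ℝ J × (Fin n → Euc d) |
        ∑ i : J, (p.1 : J → ℝ) i • p.2 i = p.2 j + q} := by
    ext x
    have hr : x '' J = Set.range (fun i : J => x i) := by
      ext y; simp
    have hl : Set.range (fun i : J => x i) = Fintype.linearCombination ℝ (fun i : J => x i) ''
        Set.range (fun i : J => (Pi.single i 1 : J → ℝ)) := by
      rw [← Set.range_comp]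
      congr 1
      ext1 i
      simp
    rw [Set.mem_ofPred_eq, hr, hl, ← LinearMap.image_convexHull,
      convexHull_rangle_single_eq_stdSimplex]
    simp only [Set.mem_image, Fintype.linearCombination_apply, Set.mem_ofPred_eq, Prod.exists,
      exists_eq_right, Subtype.exists]
    exact exists_congr fun w => ⟨fun h => ⟨h.1, h.2⟩, fun ⟨h₁, h₂⟩ => ⟨h₁, h₂⟩⟩
  rw [hset]
  refine isClosedMap_snd_of_compactSpace _ (isClosed_eq ?_ ?_)
  · refine continuous_finsetSum _ fun i _ => ?_
    refine Continuous.fun_smul (f := fun p : stdSimplex ℝ J × (Fin n → Euc d) =>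
      (p.1 : J → ℝ) i) ?_ ?_
    · exact (continuous_apply i).comp (continuous_subtype_val.comp continuous_fst)
    · exact (continuous_apply _).comp continuous_snd
  · fun_prop

/-- The condition that a point of a tuple lies in the interior of the convex hull of other
points of the tuple is measurable. -/
lemma measurableSet_setOf_mem_interior_convexHull {d n : ℕ} (j : Fin n) (J : Set (Fin n)) :
    MeasurableSet {x : Fin n → Euc d | x j ∈ interior (convexHull ℝ (x '' J))} := by
  have hset : {x : Fin n → Euc d | x j ∈ interior (convexHull ℝ (x '' J))} =
      ⋃ m : ℕ, ⋂ q : {i : ℕ // ‖TopologicalSpace.denseSeq (Euc d) i‖ < 1 / ((m : ℝ) + 1)},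
        {x | x j + TopologicalSpace.denseSeq (Euc d) q ∈ convexHull ℝ (x '' J)} := by
    ext x
    simp only [Set.mem_ofPred_eq, Set.mem_iUnion, Set.mem_iInter, Subtype.forall]
    rw [mem_interior_iff_mem_nhds, Metric.mem_nhds_iff]
    constructor
    · rintro ⟨ε, hε, hb⟩
      obtain ⟨m, hm⟩ := exists_nat_one_div_lt hε
      refine ⟨m, fun i hi => hb ?_⟩
      simpa using hi.trans hm
    · rintro ⟨m, hm⟩
      refine ⟨1 / ((m : ℝ) + 1), by positivity, ?_⟩
      have hcl : IsClosed (convexHull ℝ (x '' J)) :=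
        ((Set.toFinite J).image x).isClosed_convexHull ℝ
      intro y hy
      have hd := (TopologicalSpace.denseRange_denseSeq (Euc d)).open_subset_closure_inter
        (Metric.isOpen_ball (x := (0 : Euc d)) (ε := 1 / ((m : ℝ) + 1)))
      have hy' : y - x j ∈ Metric.ball (0 : Euc d) (1 / ((m : ℝ) + 1)) := by
        simpa [dist_eq_norm] using hy
      have hc : IsClosed ((fun t => x j + t) ⁻¹' convexHull ℝ (x '' J)) :=
        hcl.preimage (by fun_prop)
      have := closure_minimal (t := (fun t => x j + t) ⁻¹' convexHull ℝ (x '' J)) ?_ hc (hd hy')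
      · simpa using this
      · rintro _ ⟨ht, i, rfl⟩
        exact hm i (by simpa using ht)
  rw [hset]
  exact .iUnion fun m => .iInter fun q => (isClosed_setOf_add_mem_convexHull j _ J).measurableSet

/-- An index set is `IsLeastFiber x I` if every index in it is the least one with its value. -/
def IsLeastFiber {d n : ℕ} (x : Fin n → Euc d) (I : Finset (Fin n)) : Prop :=
  ∀ i ∈ I, ∀ j < i, x j ≠ x i

lemma IsLeastFiber.injOn {d n : ℕ} {x : Fin n → Euc d} {I : Finset (Fin n)}
    (h : IsLeastFiber x I) : Set.InjOn x I := by
  intro i hi j hj hij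
  rcases lt_trichotomy i j with hlt | heq | hlt
  · exact absurd hij (h j hj i hlt)
  · exact heq
  · exact absurd hij.symm (h i hi j hlt)

open Classical in
lemma holeCount_eq_card {d k n : ℕ} (x : Fin n → Euc d) :
    holeCount d k n x = (Finset.univ.filter fun I : Finset (Fin n) =>
      IsLeastFiber x I ∧ I.card = k ∧ (∀ i ∈ I, x i ∉ convexHull ℝ (x '' (I \ {i}))) ∧
        ∀ j, x j ∉ interior (convexHull ℝ (x '' I))).card := by
  have key : ∀ I : Finset (Fin n), IsLeastFiber x I →
      (IsHole k (Finset.image x Finset.univ) (I.image x) ↔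
        I.card = k ∧ (∀ i ∈ I, x i ∉ convexHull ℝ (x '' (I \ {i}))) ∧
        ∀ j, x j ∉ interior (convexHull ℝ (x '' I))) := by
    intro I hI
    have himg : ∀ i ∈ I, x '' (I \ {i}) = x '' I \ {x i} := by
      intro i hi
      rw [hI.injOn.image_sdiff_subset (by simpa using hi), Set.image_singleton]
    simp only [IsHole, InConvexPosition, Finset.coe_image, Finset.card_image_of_injOn hI.injOn]
    constructor
    · rintro ⟨-, h1, h2, h3⟩
      refine ⟨h1, fun i hi => ?_, fun j => h3 _ (by simp)⟩
      rw [himg i hi]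
      exact h2 _ (Set.mem_image_of_mem x hi)
    · rintro ⟨h1, h2, h3⟩
      refine ⟨Finset.image_subset_image (Finset.subset_univ _), h1, ?_, ?_⟩
      · rintro _ ⟨i, hi, rfl⟩
        rw [← himg i hi]
        exact h2 i hi
      · intro p hp
        obtain ⟨j, -, rfl⟩ := Finset.mem_image.1 hp
        exact h3 j
  symm
  unfold holeCount
  refine Finset.card_bij (fun I _ => I.image x) ?_ ?_ ?_
  · intro I hI
    rw [Finset.mem_filter] at hI
    rw [Finset.mem_filter, Finset.mem_powerset]
    exact ⟨Finset.image_subset_image (Finset.subset_univ _), (key I hI.2.1).2 hI.2.2⟩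
  · have hsub : ∀ I J : Finset (Fin n), IsLeastFiber x I → IsLeastFiber x J →
        I.image x = J.image x → I ⊆ J := by
      intro I J hI hJ h i hi
      have : x i ∈ J.image x := h ▸ Finset.mem_image_of_mem x hi
      obtain ⟨j, hj, hji⟩ := Finset.mem_image.1 this
      rcases lt_trichotomy i j with hlt | rfl | hlt
      · exact absurd hji.symm (hJ j hj i hlt)
      · exact hj
      · exact absurd hji (hI i hi j hlt)
    intro I hI J hJ h
    rw [Finset.mem_filter] at hI hJ
    exact (hsub I J hI.2.1 hJ.2.1 h).antisymm (hsub J I hJ.2.1 hI.2.1 h.symm)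
  · intro H hH
    rw [Finset.mem_filter, Finset.mem_powerset] at hH
    obtain ⟨hHs, hH⟩ := hH
    set I : Finset (Fin n) := Finset.univ.filter fun i => x i ∈ H ∧ ∀ j < i, x j ≠ x i with hIdef
    have hI : IsLeastFiber x I := fun i hi => (Finset.mem_filter.1 hi).2.2
    have himg : I.image x = H := by
      ext p
      constructor
      · intro hp
        obtain ⟨i, hi, rfl⟩ := Finset.mem_image.1 hp
        exact (Finset.mem_filter.1 hi).2.1
      · intro hp
        obtain ⟨i, -, hi⟩ := Finset.mem_image.1 (hHs hp)
        obtain ⟨m, hm, hmin⟩ := WellFounded.has_min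
          (wellFounded_lt : WellFounded ((· < ·) : Fin n → Fin n → Prop)) {i | x i = p} ⟨i, hi⟩
        refine Finset.mem_image.2 ⟨m, ?_, hm⟩
        refine Finset.mem_filter.2 ⟨Finset.mem_univ _, ?_, fun j hj hjm => ?_⟩
        · rw [show x m = p from hm]; exact hp
        · exact hmin j (hjm.trans hm) hj
    refine ⟨I, Finset.mem_filter.2 ⟨Finset.mem_univ _, hI, (key I hI).1 ?_⟩, himg⟩
    rw [himg]
    exact hH

lemma measurable_holeCount (d k n : ℕ) : Measurable (holeCount d k n) := by
  classical
  have h : holeCount d k n = fun x => ∑ I : Finset (Fin n),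
      if IsLeastFiber x I ∧ I.card = k ∧ (∀ i ∈ I, x i ∉ convexHull ℝ (x '' (I \ {i}))) ∧
        ∀ j, x j ∉ interior (convexHull ℝ (x '' I)) then 1 else 0 := by
    funext x
    rw [holeCount_eq_card, Finset.card_filter]
  rw [h]
  refine Finset.measurable_sum _ fun I _ => Measurable.ite ?_ measurable_const measurable_const
  have h₁ : MeasurableSet {x : Fin n → Euc d | IsLeastFiber x I} := by
    simp only [IsLeastFiber, Set.ofPred_forall]
    refine .iInter fun i => .iInter fun _ => .iInter fun j => .iInter fun _ => ?_
    exact (measurableSet_eq_fun (measurable_pi_apply j) (measurable_pi_apply i)).compl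
  have h₂ : MeasurableSet {x : Fin n → Euc d |
      ∀ i ∈ I, x i ∉ convexHull ℝ (x '' (I \ {i}))} := by
    simp only [Set.ofPred_forall]
    refine .iInter fun i => .iInter fun _ => ?_
    have := (isClosed_setOf_add_mem_convexHull i (0 : Euc d) (I \ {i})).measurableSet.compl
    simp only [add_zero] at this
    exact this
  have h₃ : MeasurableSet {x : Fin n → Euc d |
      ∀ j, x j ∉ interior (convexHull ℝ (x '' I))} := by
    simp only [Set.ofPred_forall]
    refine .iInter fun j => ?_
    exact (measurableSet_setOf_mem_interior_convexHull j (I : Set (Fin n))).compl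
  exact h₁.inter ((MeasurableSet.const _).inter (h₂.inter h₃))

end Measurability

section Geometry

/-- A point of a finite set in convex position is not interior to the convex hull. -/
lemma notMem_interior_convexHull_of_notMem_convexHull_sdiff {d : ℕ} {P : Set (Euc d)}
    (hP : P.Finite) {p : Euc d} (hne : (P \ {p}).Nonempty)
    (hp : p ∉ convexHull ℝ (P \ {p})) :
    p ∉ interior (convexHull ℝ P) := by
  intro hxint
  obtain ⟨f, u, hu, hf⟩ := geometric_hahn_banach_point_closed (convex_convexHull ℝ (P \ {p}))
    ((hP.subset Set.sdiff_subset).isClosed_convexHull ℝ) hp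
  have hsub : convexHull ℝ P ⊆ {x | f p ≤ f x} := by
    refine convexHull_min (fun x hx => ?_) (convex_halfSpace_ge f.toLinearMap.isLinear _)
    by_cases hxp : x = p
    · rw [hxp]; exact le_refl (f p)
    · exact (hu.trans (hf x (subset_convexHull ℝ _ ⟨hx, hxp⟩))).le
  by_cases h0 : f = 0
  · subst h0
    obtain ⟨q, hq⟩ := hne
    have := hu.trans (hf q (subset_convexHull ℝ _ hq))
    simp at this
  · have hopen : IsOpenMap f := f.isOpenMap_of_ne_zero h0
    have := hopen.image_interior_subset (convexHull ℝ P) (Set.mem_image_of_mem f hxint)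
    have h2 : interior (f '' convexHull ℝ P) ⊆ interior (Set.Ici (f p)) :=
      interior_mono (by rintro _ ⟨x, hx, rfl⟩; exact hsub hx)
    have h3 := h2 this
    simp at h3

/-- The centered closed cube with half side `r`. -/
def cube (d : ℕ) (r : ℝ) : Set (Euc d) := {x | ∀ i, |x i| ≤ r}

lemma convex_cube (d : ℕ) (r : ℝ) : Convex ℝ (cube d r) := by
  intro x hx y hy a b ha hb hab i
  simp only [PiLp.add_apply, PiLp.smul_apply, smul_eq_mul]
  calc |a * x i + b * y i| ≤ |a * x i| + |b * y i| := abs_add_le _ _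
    _ = a * |x i| + b * |y i| := by rw [abs_mul, abs_mul, abs_of_nonneg ha, abs_of_nonneg hb]
    _ ≤ a * r + b * r := by gcongr; exacts [hx i, hy i]
    _ = r := by rw [← add_mul, hab, one_mul]

lemma cube_eq_preimage (d : ℕ) (r : ℝ) :
    cube d r = WithLp.ofLp ⁻¹' (Set.univ.pi fun _ : Fin d => Set.Icc (-r) r) := by
  ext x
  simp only [cube, abs_le, Set.mem_preimage, Set.mem_pi, Set.mem_univ, true_imp_iff, Set.mem_Icc,
    Set.mem_ofPred_eq]

lemma measurableSet_cube (d : ℕ) (r : ℝ) : MeasurableSet (cube d r) := by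
  rw [cube_eq_preimage]
  exact (PiLp.volume_preserving_ofLp (Fin d)).measurable
    (.univ_pi fun _ => measurableSet_Icc)

lemma volume_cube (d : ℕ) {r : ℝ} (hr : 0 ≤ r) :
    volume (cube d r) = ENNReal.ofReal ((2 * r) ^ d) := by
  rw [cube_eq_preimage, (PiLp.volume_preserving_ofLp (Fin d)).measure_preimage
    (MeasurableSet.univ_pi fun _ => measurableSet_Icc).nullMeasurableSet, volume_pi_pi]
  simp only [Real.volume_Icc, Finset.prod_const, Finset.card_univ, Fintype.card_fin]
  rw [ENNReal.ofReal_pow (by linarith)]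
  congr 2
  ring

lemma volume_image_affineMap {d : ℕ} (T : Euc d →ᵃ[ℝ] Euc d) (s : Set (Euc d)) :
    volume (T '' s) = ENNReal.ofReal |LinearMap.det T.linear| * volume s := by
  have : T '' s = (fun x => x + T 0) '' (T.linear '' s) := by
    rw [Set.image_image]
    refine Set.image_congr fun x _ => ?_
    have := congrFun T.decomp x
    simpa using this
  rw [this, Set.image_add_right, measure_preimage_add_right, Measure.addHaar_image_linearMap]

lemma injective_of_det_linear_ne_zero {d : ℕ} {T : Euc d →ᵃ[ℝ] Euc d}
    (h : LinearMap.det T.linear ≠ 0) : Function.Injective T := by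
  rw [← T.linear_injective_iff]
  exact (LinearMap.equivOfDetNeZero T.linear h).injective

end Geometry

section InscribedCube

open Module

/-- Replacing one entry of the image of a basis under a linear map multiplies the determinant by
the corresponding coordinate. -/
lemma det_update_linearMap {d : ℕ} (b : Basis (Fin d) ℝ (Euc d)) (L : Euc d →ₗ[ℝ] Euc d)
    (i : Fin d) (w : Euc d) :
    b.det (Function.update (L ∘ b) i (L w)) = LinearMap.det L * b.repr w i := by
  rw [← Function.comp_update, Basis.det_comp]
  congr 1
  rw [Basis.det_apply, Basis.toMatrix_update, Basis.toMatrix_self]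
  rw [← Matrix.cramer_apply, Matrix.cramer_one]
  rfl

/-- A convex body of unit volume contains an affine image of a cube of volume bounded below. -/
lemma exists_affineMap_image_cube_subset {d : ℕ} (hd : 0 < d) {R : ℝ} (hR : 0 < R)
    {K : Set (Euc d)} (hK : IsConvexBody K) (hvol : volume K = 1) :
    ∃ A : Euc d →ᵃ[ℝ] Euc d, ((4 * d * R) ^ d)⁻¹ ≤ |LinearMap.det A.linear| ∧
      A '' cube d R ⊆ K := by
  obtain ⟨hconv, hcomp, x₀, hx₀⟩ := hK
  let e : Basis (Fin d) ℝ (Euc d) := (EuclideanSpace.basisFun (Fin d) ℝ).toBasis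
  have hx₀K : x₀ ∈ K := interior_subset hx₀
  have he : ∀ (w : Euc d) i, e.repr w i = w i := fun w i => by simp [e]
  have hcont : Continuous fun p : Fin d → Euc d => |e.det fun i => p i - x₀| := by
    refine continuous_abs.comp ?_
    simp only [Basis.det_apply]
    refine Continuous.matrix_det ?_
    refine continuous_matrix fun i j => ?_
    simp only [Basis.toMatrix_apply, he]
    fun_prop
  obtain ⟨p, hpK, hpmax⟩ := (isCompact_univ_pi fun _ : Fin d => hcomp).exists_isMaxOn
    ⟨fun _ => x₀, fun _ _ => hx₀K⟩ hcont.continuousOn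
  have hpK' : ∀ i, p i ∈ K := fun i => hpK i (Set.mem_univ i)
  let L : Euc d →ₗ[ℝ] Euc d := e.constr ℝ fun i => p i - x₀
  have hLe : L ∘ e = fun i => p i - x₀ := by
    funext i
    simp [L]
  have hdet : e.det (fun i => p i - x₀) = LinearMap.det L := by
    rw [← hLe, Basis.det_comp, Basis.det_self, mul_one]
  have hLsum : ∀ w, L w = ∑ i, w i • (p i - x₀) := by
    intro w
    simp only [L, Basis.constr_apply_fintype, Basis.equivFun_apply, he]
  have hL0 : LinearMap.det L ≠ 0 := by
    obtain ⟨ε, hε, hball⟩ := Metric.isOpen_iff.1 isOpen_interior x₀ hx₀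
    have hmem : (fun i => x₀ + (ε / 2) • e i) ∈ Set.univ.pi fun _ : Fin d => K := by
      intro i _
      refine interior_subset (hball ?_)
      simp only [e, OrthonormalBasis.coe_toBasis, EuclideanSpace.basisFun_apply,
        Metric.mem_ball, dist_self_add_left, norm_smul, PiLp.norm_single]
      simp [abs_of_pos hε]
      exact hε
    have h1 := hpmax hmem
    simp only [Set.mem_ofPred_eq, add_sub_cancel_left] at h1
    rw [hdet] at h1
    have h2 : (e.det fun i => (ε / 2) • e i) = (ε / 2) ^ d := by
      have := (e.det).map_smul_univ (fun _ : Fin d => ε / 2) e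
      rw [this]
      simp [Basis.det_self, div_pow]
    rw [h2] at h1
    intro h0
    rw [h0, abs_zero] at h1
    have : 0 < |(ε / 2) ^ d| := by positivity
    linarith
  have hsubset : K ⊆ (fun x => x₀ + x) '' (L '' cube d 1) := by
    intro y hy
    obtain ⟨w, hw⟩ := (LinearMap.equivOfDetNeZero L hL0).surjective (y - x₀)
    have hw : L w = y - x₀ := hw
    refine ⟨L w, ⟨w, fun i => ?_, rfl⟩, by rw [hw]; simp⟩
    have hmem : Function.update p i y ∈ Set.univ.pi fun _ : Fin d => K := by
      intro j _
      by_cases hj : j = i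
      · subst hj; simpa using hy
      · simpa [Function.update_of_ne hj] using hpK' j
    have h1 := hpmax hmem
    simp only [Set.mem_ofPred_eq] at h1
    have h2 : (fun j => Function.update p i y j - x₀) = Function.update (L ∘ e) i (L w) := by
      rw [hLe, hw]
      funext j
      by_cases hj : j = i
      · subst hj; simp
      · simp [Function.update_of_ne hj]
    rw [h2, det_update_linearMap, hdet, abs_mul, he] at h1
    have h3 : 0 < |LinearMap.det L| := abs_pos.2 hL0
    exact le_of_mul_le_mul_left (by linarith) h3
  have hdetL : ((2 : ℝ) ^ d)⁻¹ ≤ |LinearMap.det L| := by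
    have h1 := measure_mono (μ := volume) hsubset
    rw [hvol, Set.image_add_left, measure_preimage_add, Measure.addHaar_image_linearMap,
      volume_cube d zero_le_one, ← ENNReal.ofReal_mul (abs_nonneg _), ENNReal.one_le_ofReal,
      mul_one] at h1
    rw [inv_le_iff_one_le_mul₀ (by positivity)]
    exact h1
  have hd' : (0 : ℝ) < d := by exact_mod_cast hd
  set c : ℝ := (2 * d * R)⁻¹ with hc
  have hcpos : 0 < c := by positivity
  let u : Euc d := WithLp.toLp 2 fun _ => (2 * (d : ℝ))⁻¹
  refine ⟨(c • L).toAffineMap + AffineMap.const ℝ (Euc d) (x₀ + L u), ?_, ?_⟩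
  · have : ((c • L).toAffineMap + AffineMap.const ℝ (Euc d) (x₀ + L u)).linear = c • L := by
      simp
    rw [this, LinearMap.det_smul, finrank_euclideanSpace_fin, abs_mul, abs_of_pos (by positivity)]
    calc ((4 * d * R) ^ d)⁻¹ = c ^ d * (2 ^ d)⁻¹ := by
          rw [hc, inv_pow, ← mul_inv, ← mul_pow]; ring_nf
      _ ≤ _ := by gcongr
  · rintro _ ⟨w, hw, rfl⟩
    have hval : ((c • L).toAffineMap + AffineMap.const ℝ (Euc d) (x₀ + L u)) w =
        x₀ + ∑ i, (c * w i + (2 * (d : ℝ))⁻¹) • (p i - x₀) := by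
      have : ((c • L).toAffineMap + AffineMap.const ℝ (Euc d) (x₀ + L u)) w =
        x₀ + L (c • w + u) := by
        simp; abel
      rw [this, hLsum]
      simp [u]
    rw [hval]
    set t : Fin d → ℝ := fun i => c * w i + (2 * (d : ℝ))⁻¹ with ht
    have hcR : c * R = (2 * (d : ℝ))⁻¹ := by rw [hc]; field_simp
    have hcw : ∀ i, |c * w i| ≤ (2 * (d : ℝ))⁻¹ := by
      intro i
      rw [abs_mul, abs_of_pos hcpos, ← hcR]
      exact mul_le_mul_of_nonneg_left (hw i) hcpos.le
    have ht0 : ∀ i, 0 ≤ t i := fun i => by have := abs_le.1 (hcw i); simp only [ht]; linarith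
    have ht1 : ∑ i, t i ≤ 1 := by
      calc ∑ i, t i ≤ ∑ _i : Fin d, (d : ℝ)⁻¹ := by
            refine Finset.sum_le_sum fun i _ => ?_
            have := abs_le.1 (hcw i)
            have h2 : (d : ℝ)⁻¹ = (2 * (d : ℝ))⁻¹ + (2 * (d : ℝ))⁻¹ := by field_simp; norm_num
            simp only [ht]; linarith
        _ = 1 := by simp [hd'.ne']
    have hcomb : x₀ + ∑ i, t i • (p i - x₀) = (1 - ∑ i, t i) • x₀ + ∑ i, t i • p i := by
      simp only [smul_sub, Finset.sum_sub_distrib, ← Finset.sum_smul, sub_smul, one_smul]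
      abel
    rw [hcomb]
    have := hconv.sum_mem (t := (Finset.univ : Finset (Option (Fin d))))
      (w := fun o => o.elim (1 - ∑ i, t i) t) (z := fun o => o.elim x₀ p) ?_ ?_ ?_
    · simpa [Fintype.sum_option] using this
    · rintro (_ | i) _
      · simpa using ht1
      · exact ht0 i
    · simp [Fintype.sum_option]
    · rintro (_ | i) _
      · exact hx₀K
      · exact hpK' i

end InscribedCube

section Template

/-- The affine function on `ℝ^d`, constant in direction `z`, with value `a z` at `0` and value
`a j` at the `j`-th standard basis vector for `j ≠ z`. -/
noncomputable def interp {d : ℕ} (z : Fin d) (a : Fin d → ℝ) (x : Euc d) : ℝ :=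
  a z + ∑ j, (a j - a z) * x j

/-- The affine map squeezing the coordinate `z` by `ε` and adding `interp z a` to it. -/
noncomputable def squeeze {d : ℕ} (z : Fin d) (ε : ℝ) (a : Fin d → ℝ) : Euc d →ᵃ[ℝ] Euc d :=
  (LinearMap.transvection ((ε - 1) • (EuclideanSpace.proj z : Euc d →L[ℝ] ℝ).toLinearMap +
    ∑ j, (a j - a z) • (EuclideanSpace.proj j : Euc d →L[ℝ] ℝ).toLinearMap)
    (EuclideanSpace.single z 1)).toAffineMap +
    AffineMap.const ℝ (Euc d) (EuclideanSpace.single z (a z))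

lemma squeeze_apply_self {d : ℕ} (z : Fin d) (ε : ℝ) (a : Fin d → ℝ) (x : Euc d) :
    squeeze z ε a x z = ε * x z + interp z a x := by
  simp [squeeze, interp, LinearMap.transvection.apply]
  ring

lemma squeeze_apply_of_ne {d : ℕ} {z j : Fin d} (hj : j ≠ z) (ε : ℝ) (a : Fin d → ℝ)
    (x : Euc d) : squeeze z ε a x j = x j := by
  simp [squeeze, LinearMap.transvection.apply, hj]

lemma det_linear_squeeze {d : ℕ} (z : Fin d) (ε : ℝ) (a : Fin d → ℝ) :
    LinearMap.det (squeeze z ε a).linear = ε := by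
  have : (squeeze z ε a).linear =
      LinearMap.transvection ((ε - 1) • (EuclideanSpace.proj z : Euc d →L[ℝ] ℝ).toLinearMap +
        ∑ j, (a j - a z) • (EuclideanSpace.proj j : Euc d →L[ℝ] ℝ).toLinearMap)
        (EuclideanSpace.single z 1) := by
    simp [squeeze]
  rw [this, LinearMap.transvection.det]
  simp

lemma interp_sub {d : ℕ} (z : Fin d) (a b : Fin d → ℝ) (x : Euc d) :
    interp z (a - b) x = interp z a x - interp z b x := by
  simp only [interp, Pi.sub_apply]
  rw [add_sub_add_comm, ← Finset.sum_sub_distrib]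
  congr 1
  exact Finset.sum_congr rfl fun j _ => by ring

lemma interp_congr {d : ℕ} (z : Fin d) (a : Fin d → ℝ) {x y : Euc d}
    (h : ∀ j ≠ z, x j = y j) : interp z a x = interp z a y := by
  unfold interp
  congr 1
  refine Finset.sum_congr rfl fun j _ => ?_
  by_cases hj : j = z
  · simp [hj]
  · rw [h j hj]

lemma abs_interp_le {d : ℕ} (z : Fin d) {a : Fin d → ℝ} {M r : ℝ}
    (ha : ∀ j, |a j| ≤ M) {x : Euc d} (hx : x ∈ cube d r) :
    |interp z a x| ≤ M + d * (2 * M * r) := by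
  have hM : 0 ≤ M := (abs_nonneg _).trans (ha z)
  calc |interp z a x| ≤ |a z| + |∑ j, (a j - a z) * x j| := abs_add_le _ _
    _ ≤ M + ∑ _j : Fin d, 2 * M * r := by
      gcongr
      · exact ha z
      · refine (Finset.abs_sum_le_sum_abs _ _).trans (Finset.sum_le_sum fun j _ => ?_)
        rw [abs_mul]
        have h1 : |a j - a z| ≤ 2 * M := by
          have := abs_sub (a j) (a z)
          linarith [ha j, ha z]
        exact mul_le_mul h1 (hx j) (abs_nonneg _) (by linarith)
    _ = _ := by simp

lemma squeeze_mem_cube {d : ℕ} (z : Fin d) {ε : ℝ} (hε : 0 ≤ ε) (hε1 : ε ≤ 1) {a : Fin d → ℝ}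
    {M r : ℝ} (ha : ∀ j, |a j| ≤ M) (hr : 0 ≤ r) {x : Euc d} (hx : x ∈ cube d r) :
    squeeze z ε a x ∈ cube d (r + (M + d * (2 * M * r))) := by
  have hM : 0 ≤ M := (abs_nonneg _).trans (ha z)
  intro j
  by_cases hj : j = z
  · subst hj
    rw [squeeze_apply_self]
    refine (abs_add_le _ _).trans (add_le_add ?_ (abs_interp_le _ ha hx))
    rw [abs_mul, abs_of_nonneg hε]
    nlinarith [hx j, abs_nonneg (x j)]
  · rw [squeeze_apply_of_ne hj]
    have : 0 ≤ M + d * (2 * M * r) := by positivity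
    linarith [hx j]

/-- If the `interp`-weights at `x` are concentrated at `i`, then `interp z a x` is comparable to
the largest absolute value `|a i|`. -/
lemma half_abs_le_abs_interp {d : ℕ} (z i : Fin d) {a : Fin d → ℝ} (hi : ∀ j, |a j| ≤ |a i|)
    {x : Euc d} (hx : ∀ j ≠ z, |x j - if j = i then 1 else 0| ≤ (4 * (d : ℝ))⁻¹) :
    |a i| / 2 ≤ |interp z a x| := by
  have hd : (0 : ℝ) < d := by exact_mod_cast i.pos
  have hexact : a z + ∑ j, (a j - a z) * (if j = i then 1 else 0) = a i := by simp
  have hdiff : |interp z a x - a i| ≤ |a i| / 2 := by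
    have h1 : interp z a x - a i = ∑ j, (a j - a z) * (x j - if j = i then 1 else 0) := by
      rw [← hexact, interp, add_sub_add_left_eq_sub, ← Finset.sum_sub_distrib]
      exact Finset.sum_congr rfl fun j _ => by ring
    rw [h1]
    calc _ ≤ ∑ _j : Fin d, 2 * |a i| * (4 * (d : ℝ))⁻¹ := by
          refine (Finset.abs_sum_le_sum_abs _ _).trans (Finset.sum_le_sum fun j _ => ?_)
          by_cases hj : j = z
          · subst hj; simp; positivity
          · rw [abs_mul]
            have h1 : |a j - a z| ≤ 2 * |a i| := by
              have := abs_sub (a j) (a z)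
              linarith [hi j, hi z]
            exact mul_le_mul h1 (hx j hj) (abs_nonneg _) (by positivity)
      _ = |a i| / 2 := by simp; field_simp; ring
  have := abs_sub_abs_le_abs_sub (a i) (interp z a x)
  rw [abs_sub_comm] at this
  linarith

/-- There are `k` open sets such that any choice of one point from each is in convex position,
and such that on some of them any given function `interp z a` is large. -/
lemma exists_template {d k : ℕ} (hd : 2 ≤ d) (hk : d ≤ k) :
    ∃ (z : Fin d) (r : ℝ) (U : Fin k → Set (Euc d)), 0 < r ∧ (∀ i, IsOpen (U i)) ∧
      (∀ i, (U i).Nonempty) ∧ (∀ i, U i ⊆ cube d r) ∧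
      (∀ u : Fin k → Euc d, (∀ i, u i ∈ U i) → ∀ i, u i ∉ convexHull ℝ (u '' {i}ᶜ)) ∧
      ∀ a : Fin d → ℝ, ∃ i, ∀ x ∈ U i, ∀ j, |a j| / 2 ≤ |interp z a x| := by
  let z : Fin d := ⟨0, by omega⟩
  let o : Fin d := ⟨1, by omega⟩
  -- integer points in the hyperplane `x z = 0`, to be lifted to a paraboloid
  let y : Fin k → Fin d → ℤ := fun i j => if j = z then 0 else
    if i.1 < d then (if j.1 = i.1 then 1 else 0) else (if j = o then i.1 else 0)
  have hyz : ∀ i, y i z = 0 := fun i => by simp [y]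
  have hyinj : Function.Injective y := by
    intro i l h
    have hj : ∀ j, y i j = y l j := fun j => congrFun h j
    have hval : ∀ j : Fin d, j.1 ≠ 0 → y i j = if i.1 < d then (if j.1 = i.1 then 1 else 0) else
        (if j.1 = 1 then (i.1 : ℤ) else 0) := fun j hj => by simp [y, z, o, Fin.ext_iff, hj]
    have hval' : ∀ j : Fin d, j.1 ≠ 0 → y l j = if l.1 < d then (if j.1 = l.1 then 1 else 0) else
        (if j.1 = 1 then (l.1 : ℤ) else 0) := fun j hj => by simp [y, z, o, Fin.ext_iff, hj]
    have heq : ∀ t, t < d → t ≠ 0 →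
        (if i.1 < d then (if t = i.1 then 1 else 0) else (if t = 1 then (i.1 : ℤ) else 0)) =
        if l.1 < d then (if t = l.1 then 1 else 0) else (if t = 1 then (l.1 : ℤ) else 0) :=
      fun t ht ht0 => by
        have := hj ⟨t, ht⟩
        rwa [hval _ ht0, hval' _ ht0] at this
    have ho := heq 1 (by omega) one_ne_zero
    ext
    by_contra hil
    by_cases hi : i.1 < d <;> by_cases hl : l.1 < d
    · by_cases hi0 : i.1 = 0
      · have := heq l.1 hl (by omega)
        simp [hi, hl, Ne.symm hil] at this
      · have := heq i.1 hi hi0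
        simp [hi, hl, hil] at this
    all_goals
      simp only [hi, hl, if_true, if_false] at ho
      grind
  let p : Fin k → Euc d := fun i => WithLp.toLp 2 fun j =>
    if j = z then ∑ t, (y i t : ℝ) ^ 2 else y i j
  let ℓ : Fin k → Euc d → ℝ := fun i x =>
    x z - 2 * ∑ j, (y i j : ℝ) * x j + ∑ j, (y i j : ℝ) ^ 2
  have hℓcont : ∀ i, Continuous (ℓ i) := fun i => by
    simp only [ℓ]
    fun_prop
  have hℓp : ∀ i l, ℓ i (p l) = ∑ j, ((y l j : ℝ) - y i j) ^ 2 := by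
    intro i l
    have h1 : ∀ j, (y i j : ℝ) * p l j = y i j * y l j := by
      intro j
      by_cases hj : j = z
      · subst hj; simp [hyz]
      · simp [p, hj]
    have h2 : p l z = ∑ t, (y l t : ℝ) ^ 2 := by simp [p]
    simp only [ℓ, h1, h2]
    rw [Finset.mul_sum, ← Finset.sum_sub_distrib, ← Finset.sum_add_distrib]
    exact Finset.sum_congr rfl fun j _ => by ring
  have hℓself : ∀ i, ℓ i (p i) = 0 := fun i => by simp [hℓp]
  have hℓne : ∀ i l, l ≠ i → 1 ≤ ℓ i (p l) := by
    intro i l hli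
    rw [hℓp]
    obtain ⟨j, hj⟩ : ∃ j, y l j ≠ y i j := by
      by_contra! h
      exact hli (hyinj (funext h))
    have h1 : (1 : ℝ) ≤ ((y l j : ℝ) - y i j) ^ 2 := by
      have : (1 : ℤ) ≤ (y l j - y i j) ^ 2 := by
        have : 0 < (y l j - y i j) ^ 2 := by
          have := sub_ne_zero.2 hj
          positivity
        omega
      exact_mod_cast this
    exact h1.trans (Finset.single_le_sum (f := fun j => ((y l j : ℝ) - y i j) ^ 2)
      (fun _ _ => sq_nonneg _) (Finset.mem_univ j))
  obtain ⟨r, hr0, hr⟩ : ∃ r : ℝ, 0 < r ∧ ∀ i j, |p i j| < r := by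
    refine ⟨∑ i, ∑ j, |p i j| + 1, by positivity, fun i j => ?_⟩
    have h1 : |p i j| ≤ ∑ j, |p i j| :=
      Finset.single_le_sum (f := fun j => |p i j|) (fun _ _ => abs_nonneg _) (Finset.mem_univ j)
    have h2 : ∑ j, |p i j| ≤ ∑ i, ∑ j, |p i j| :=
      Finset.single_le_sum (f := fun i => ∑ j, |p i j|)
        (fun _ _ => Finset.sum_nonneg fun _ _ => abs_nonneg _) (Finset.mem_univ i)
    linarith
  have hd0 : 0 < (4 * (d : ℝ))⁻¹ := by
    have : (0 : ℝ) < d := by exact_mod_cast (by omega : 0 < d)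
    positivity
  let U : Fin k → Set (Euc d) := fun i =>
    {x | (∀ j, |x j| < r) ∧ (∀ j, j ≠ z → |x j - p i j| < (4 * (d : ℝ))⁻¹) ∧
      ℓ i x < 1 / 2 ∧ ∀ l, l ≠ i → 1 / 2 < ℓ l x}
  refine ⟨z, r, U, hr0, fun i => ?_, fun i => ⟨p i, hr i, ?_, ?_, ?_⟩, ?_, ?_, ?_⟩
  · have h1 : IsOpen {x : Euc d | ∀ j, |x j| < r} := by
      simp only [Set.ofPred_forall]
      exact isOpen_iInter_of_finite fun j => isOpen_lt (by fun_prop) (by fun_prop)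
    have h2 : IsOpen {x : Euc d | ∀ j, j ≠ z → |x j - p i j| < (4 * (d : ℝ))⁻¹} := by
      simp only [Set.ofPred_forall]
      exact isOpen_iInter_of_finite fun j => isOpen_iInter_of_finite fun _ =>
        isOpen_lt (by fun_prop) (by fun_prop)
    have h3 : IsOpen {x : Euc d | ℓ i x < 1 / 2} := isOpen_lt (hℓcont i) (by fun_prop)
    have h4 : IsOpen {x : Euc d | ∀ l, l ≠ i → 1 / 2 < ℓ l x} := by
      simp only [Set.ofPred_forall]
      exact isOpen_iInter_of_finite fun l => isOpen_iInter_of_finite fun _ =>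
        isOpen_lt (by fun_prop) (hℓcont l)
    exact h1.inter (h2.inter (h3.inter h4))
  · intro j _
    simpa using hd0
  · rw [hℓself]; norm_num
  · intro l hl
    linarith [hℓne l i hl.symm]
  · exact fun i x hx j => (hx.1 j).le
  · intro u hu i hmem
    have hsub : convexHull ℝ (u '' {i}ᶜ) ⊆ {x | 1 / 2 < ℓ i x} := by
      refine convexHull_min ?_ ?_
      · rintro _ ⟨l, hl, rfl⟩
        exact (hu l).2.2.2 i (Ne.symm hl)
      · have hlin : IsLinearMap ℝ fun x : Euc d => x z - 2 * ∑ j, (y i j : ℝ) * x j := by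
          constructor
          · intro x w
            simp only [PiLp.add_apply, mul_add, Finset.sum_add_distrib]
            ring
          · intro c x
            simp only [PiLp.smul_apply, smul_eq_mul, mul_sub, Finset.mul_sum]
            congr 1
            exact Finset.sum_congr rfl fun j _ => by ring
        have := convex_halfSpace_gt hlin (1 / 2 - ∑ j, (y i j : ℝ) ^ 2)
        convert this using 2
        ext x
        simp only [ℓ]
        constructor <;> intro h <;> linarith
    have h1 : 1 / 2 < ℓ i (u i) := hsub hmem
    linarith [(hu i).2.2.1]
  · intro a
    obtain ⟨i, -, hi⟩ := Finset.exists_max_image Finset.univ (fun j => |a j|) ⟨z, Finset.mem_univ z⟩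
    refine ⟨Fin.castLE hk i, fun x hx j => ?_⟩
    have h1 : |a i| / 2 ≤ |interp z a x| := by
      refine half_abs_le_abs_interp z i (fun j => hi j (Finset.mem_univ j)) fun j hj => ?_
      have h2 := (hx.2.1 j hj).le
      have h3 : p (Fin.castLE hk i) j = if j = i then 1 else 0 := by
        simp [p, y, hj, ← Fin.ext_iff]
      rwa [h3] at h2
    linarith [hi j (Finset.mem_univ j)]

end Template

section Probability

/-- The event that the points with indices in `I` fall into prescribed regions `W` and all other
points fall into `K` but avoid `D`. -/
noncomputable def regionEvent {d k n : ℕ} (K D : Set (Euc d)) (W : Fin k → Set (Euc d))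
    (I : {I : Finset (Fin n) // I.card = k}) : Set (Fin n → Euc d) :=
  Set.univ.pi fun j => if h : j ∈ I.1 then W (I.1.equivFinOfCardEq I.2 ⟨j, h⟩) else K \ D

lemma mem_region_of_mem_regionEvent {d k n : ℕ} {K D : Set (Euc d)} {W : Fin k → Set (Euc d)}
    {I : {I : Finset (Fin n) // I.card = k}} {x : Fin n → Euc d} (hx : x ∈ regionEvent K D W I)
    (i : Fin k) : x ((I.1.equivFinOfCardEq I.2).symm i) ∈ W i := by
  have := hx ((I.1.equivFinOfCardEq I.2).symm i) (Set.mem_univ _)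
  simpa using this

lemma notMem_of_mem_regionEvent {d k n : ℕ} {K D : Set (Euc d)} {W : Fin k → Set (Euc d)}
    {I : {I : Finset (Fin n) // I.card = k}} {x : Fin n → Euc d} (hx : x ∈ regionEvent K D W I)
    {j : Fin n} (hj : j ∉ I.1) : x j ∉ D := by
  have := hx j (Set.mem_univ _)
  simp only [hj, dite_false] at this
  exact this.2

lemma mem_of_mem_regionEvent {d k n : ℕ} {K D : Set (Euc d)} {W : Fin k → Set (Euc d)}
    (hWD : ∀ i, W i ⊆ D) {I : {I : Finset (Fin n) // I.card = k}} {x : Fin n → Euc d}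
    (hx : x ∈ regionEvent K D W I) {j : Fin n} (hj : j ∈ I.1) : x j ∈ D := by
  have := mem_region_of_mem_regionEvent hx (I.1.equivFinOfCardEq I.2 ⟨j, hj⟩)
  rw [Equiv.symm_apply_apply] at this
  exact hWD _ this

lemma measurableSet_regionEvent {d k n : ℕ} {K D : Set (Euc d)} {W : Fin k → Set (Euc d)}
    (hK : MeasurableSet K) (hD : MeasurableSet D) (hW : ∀ i, MeasurableSet (W i))
    (I : {I : Finset (Fin n) // I.card = k}) : MeasurableSet (regionEvent K D W I) := by
  refine .univ_pi fun j => ?_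
  split_ifs
  · exact hW _
  · exact hK.diff hD

open Classical in
lemma isHole_of_mem_regionEvent {d k n : ℕ} (hk : 2 ≤ k) {K D : Set (Euc d)}
    {W : Fin k → Set (Euc d)} (hWD : ∀ i, W i ⊆ D) (hDconv : Convex ℝ D)
    (hpos : ∀ u : Fin k → Euc d, (∀ i, u i ∈ W i) → ∀ i, u i ∉ convexHull ℝ (u '' {i}ᶜ))
    {I : {I : Finset (Fin n) // I.card = k}} {x : Fin n → Euc d}
    (hx : x ∈ regionEvent K D W I) :
    IsHole k (Finset.image x Finset.univ) (I.1.image x) := by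
  set σ := I.1.equivFinOfCardEq I.2 with hσ
  let u : Fin k → Euc d := fun i => x (σ.symm i)
  have hu := hpos u (mem_region_of_mem_regionEvent hx)
  have huinj : Function.Injective u := by
    intro i l hil
    by_contra hne
    exact hu i (subset_convexHull ℝ _ ⟨l, Ne.symm hne, hil.symm⟩)
  have himg : I.1.image x = Finset.univ.image u := by
    ext p
    simp only [Finset.mem_image, Finset.mem_univ, true_and]
    constructor
    · rintro ⟨j, hj, rfl⟩
      exact ⟨σ ⟨j, hj⟩, by simp [u]⟩
    · rintro ⟨i, rfl⟩
      exact ⟨σ.symm i, (σ.symm i).2, rfl⟩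
  have hcp : InConvexPosition ((I.1.image x : Finset (Euc d)) : Set (Euc d)) := by
    intro p hp hmem
    rw [himg] at hp hmem
    obtain ⟨i, -, rfl⟩ := Finset.mem_image.1 (Finset.mem_coe.1 hp)
    refine hu i (convexHull_mono ?_ hmem)
    rintro q ⟨hq, hqi⟩
    obtain ⟨l, -, rfl⟩ := Finset.mem_image.1 (Finset.mem_coe.1 hq)
    exact ⟨l, fun h => hqi (by rw [h]; rfl), rfl⟩
  have hcard : (I.1.image x).card = k := by
    rw [himg, Finset.card_image_of_injective _ huinj, Finset.card_univ, Fintype.card_fin]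
  refine ⟨Finset.image_subset_image (Finset.subset_univ _), hcard, hcp, fun p hp => ?_⟩
  by_cases hpH : p ∈ I.1.image x
  · refine notMem_interior_convexHull_of_notMem_convexHull_sdiff (Finset.finite_toSet _) ?_
      (hcp p (Finset.mem_coe.2 hpH))
    obtain ⟨q, hq, hqp⟩ := Finset.exists_mem_ne (by omega : 1 < (I.1.image x).card) p
    exact ⟨q, Finset.mem_coe.2 hq, hqp⟩
  · obtain ⟨j, -, rfl⟩ := Finset.mem_image.1 hp
    have hj : j ∉ I.1 := fun h => hpH (Finset.mem_image_of_mem x h)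
    intro hxint
    refine notMem_of_mem_regionEvent hx hj (convexHull_min ?_ hDconv (interior_subset hxint))
    intro q hq
    obtain ⟨l, hl, rfl⟩ := Finset.mem_image.1 (Finset.mem_coe.1 hq)
    exact mem_of_mem_regionEvent hWD hx hl

lemma le_measure_regionEvent {d k n : ℕ} {μ : Measure (Euc d)} [IsProbabilityMeasure μ]
    {K D : Set (Euc d)} {W : Fin k → Set (Euc d)} {w ε : ℝ} (hw : 0 ≤ w)
    (hε : (n : ℝ) * ε ≤ 1 / 2) (hε0 : 0 ≤ ε) (hε1 : ε ≤ 1)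
    (hW : ∀ i, ENNReal.ofReal w ≤ μ (W i))
    (hD : ENNReal.ofReal (1 - ε) ≤ μ (K \ D)) (I : {I : Finset (Fin n) // I.card = k}) :
    w ^ k / 2 ≤ (Measure.pi fun _ : Fin n => μ).real (regionEvent K D W I) := by
  classical
  rw [measureReal_def, regionEvent, Measure.pi_pi]
  have h1 : ENNReal.ofReal (w ^ k / 2) ≤
      ∏ j : Fin n, μ (if h : j ∈ I.1 then W (I.1.equivFinOfCardEq I.2 ⟨j, h⟩) else K \ D) := by
    calc ENNReal.ofReal (w ^ k / 2)
        ≤ ENNReal.ofReal (w ^ k * (1 - ε) ^ (n - k)) := by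
          refine ENNReal.ofReal_le_ofReal ?_
          rw [div_eq_mul_inv]
          refine mul_le_mul_of_nonneg_left ?_ (by positivity)
          have hb := one_add_mul_le_pow (a := -ε) (by linarith) n
          have hle : (1 - ε) ^ n ≤ (1 - ε) ^ (n - k) :=
            pow_le_pow_of_le_one (by linarith) (by linarith) (Nat.sub_le n k)
          have : (1 + -ε) ^ n = (1 - ε) ^ n := by ring
          linarith
      _ = ∏ j : Fin n, (if j ∈ I.1 then ENNReal.ofReal w else ENNReal.ofReal (1 - ε)) := by
          rw [Finset.prod_ite, Finset.prod_const, Finset.prod_const, Finset.filter_mem_eq_inter,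
            Finset.univ_inter, I.2, ENNReal.ofReal_mul (by positivity), ENNReal.ofReal_pow hw,
            ENNReal.ofReal_pow (by linarith)]
          congr 2
          rw [Finset.filter_not, Finset.filter_mem_eq_inter, Finset.univ_inter,
            Finset.card_sdiff_of_subset (Finset.subset_univ _), I.2, Finset.card_univ,
            Fintype.card_fin]
      _ ≤ _ := by
          refine Finset.prod_le_prod' fun j _ => ?_
          split_ifs
          · exact hW _
          · exact hD
  refine (ENNReal.ofReal_le_iff_le_toReal ?_).1 h1
  exact ENNReal.prod_ne_top fun j _ => measure_ne_top _ _

/-- Lower bound for the expected number of holes from a finite family of systems of regions, such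
that a choice of points from the regions of a system determines the system. -/
lemma le_EH_of_regions {d k n : ℕ} (hk : 2 ≤ k) {K : Set (Euc d)} (hK : MeasurableSet K)
    (hvol : volume K = 1) {V : Type*} [Fintype V] {W : V → Fin k → Set (Euc d)}
    {D : V → Set (Euc d)} {w ε : ℝ} (hw : 0 ≤ w) (hε : (n : ℝ) * ε ≤ 1 / 2) (hε0 : 0 ≤ ε)
    (hε1 : ε ≤ 1) (hWm : ∀ v i, MeasurableSet (W v i)) (hDm : ∀ v, MeasurableSet (D v))
    (hWD : ∀ v i, W v i ⊆ D v) (hDK : ∀ v, D v ⊆ K) (hDconv : ∀ v, Convex ℝ (D v))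
    (hpos : ∀ v, ∀ u : Fin k → Euc d, (∀ i, u i ∈ W v i) →
      ∀ i, u i ∉ convexHull ℝ (u '' {i}ᶜ))
    (hdisj : ∀ v v', v ≠ v' → ∃ i, Disjoint (W v i) (W v' i))
    (hWvol : ∀ v i, ENNReal.ofReal w ≤ volume (W v i))
    (hDvol : ∀ v, volume (D v) ≤ ENNReal.ofReal ε) :
    (n.choose k : ℝ) * Fintype.card V * (w ^ k / 2) ≤ EH d k K n := by
  classical
  have hμ : unif K = volume.restrict K := by simp [unif, hvol]
  have : IsProbabilityMeasure (volume.restrict K) := ⟨by simp [hvol]⟩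
  unfold EH
  rw [hμ]
  set P := Measure.pi fun _ : Fin n => volume.restrict K with hP
  let E : {I : Finset (Fin n) // I.card = k} × V → Set (Fin n → Euc d) :=
    fun q => regionEvent K (D q.2) (W q.2) q.1
  have hEm : ∀ q, MeasurableSet (E q) := fun q =>
    measurableSet_regionEvent hK (hDm _) (hWm _) _
  have hEP : ∀ q, w ^ k / 2 ≤ P.real (E q) := by
    intro q
    refine le_measure_regionEvent hw hε hε0 hε1 (fun i => ?_) ?_ q.1
    · rw [Measure.restrict_apply (hWm _ _),
        Set.inter_eq_left.2 ((hWD q.2 i).trans (hDK q.2))]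
      exact hWvol _ _
    · rw [Measure.restrict_apply (hK.diff (hDm _)), Set.inter_eq_left.2 Set.sdiff_subset,
        measure_sdiff (hDK _) (hDm _).nullMeasurableSet
          (ne_top_of_le_ne_top ENNReal.ofReal_ne_top (hDvol _)), hvol,
        ENNReal.ofReal_sub _ hε0, ENNReal.ofReal_one]
      exact tsub_le_tsub_left (hDvol _) _
  have hpt : ∀ x, ∑ q, (E q).indicator (fun _ => (1 : ℝ)) x ≤ (holeCount d k n x : ℝ) := by
    intro x
    have h1 : ∑ q, (E q).indicator (fun _ => (1 : ℝ)) x =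
        ((Finset.univ.filter fun q => x ∈ E q).card : ℝ) := by
      simp [Set.indicator_apply]
    rw [h1]
    norm_cast
    unfold holeCount
    refine Finset.card_le_card_of_injOn (fun q => q.1.1.image x) ?_ ?_
    · intro q hq
      have hq : x ∈ E q := by simpa using hq
      simp only [Finset.coe_filter, Finset.mem_powerset]
      exact ⟨Finset.image_subset_image (Finset.subset_univ _),
        isHole_of_mem_regionEvent hk (hWD q.2) (hDconv q.2) (hpos q.2) hq⟩
    · rintro ⟨I, v⟩ hq ⟨I', v'⟩ hq' himg
      have hq : x ∈ E (I, v) := by simpa using hq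
      have hq' : x ∈ E (I', v') := by simpa using hq'
      have hsub : ∀ (q q' : {I : Finset (Fin n) // I.card = k} × V), x ∈ E q → x ∈ E q' →
          q.1.1.image x = q'.1.1.image x → q.1.1 ⊆ q'.1.1 := by
        intro q q' h h' himg j hj
        have : x j ∈ q'.1.1.image x := himg ▸ Finset.mem_image_of_mem x hj
        obtain ⟨l, hl, hlj⟩ := Finset.mem_image.1 this
        by_contra hj'
        exact notMem_of_mem_regionEvent h' hj' (hlj ▸ mem_of_mem_regionEvent (hWD q'.2) h' hl)
      have hI : I = I' := Subtype.ext
        ((hsub _ _ hq hq' himg).antisymm (hsub _ _ hq' hq himg.symm))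
      subst hI
      by_contra hne
      have hv : v ≠ v' := fun h => hne (by rw [h])
      obtain ⟨i, hi⟩ := hdisj v v' hv
      exact Set.disjoint_left.1 hi (mem_region_of_mem_regionEvent hq i)
        (mem_region_of_mem_regionEvent hq' i)
  have hcount : Integrable (fun x => (holeCount d k n x : ℝ)) P := by
    refine Integrable.of_bound (C := 2 ^ n)
      (measurable_from_top.comp (measurable_holeCount d k n)).aestronglyMeasurable
      (Eventually.of_forall fun x => ?_)
    rw [Real.norm_natCast]
    have h1 : holeCount d k n x ≤ 2 ^ n := by
      refine (Finset.card_filter_le _ _).trans ?_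
      rw [Finset.card_powerset]
      refine Nat.pow_le_pow_right two_pos ?_
      exact Finset.card_image_le.trans (by simp)
    exact_mod_cast h1
  calc (n.choose k : ℝ) * Fintype.card V * (w ^ k / 2)
      = ∑ _q : {I : Finset (Fin n) // I.card = k} × V, w ^ k / 2 := by
        rw [Finset.sum_const, Finset.card_univ, Fintype.card_prod, Fintype.card_finset_len,
          Fintype.card_fin, nsmul_eq_mul]
        push_cast
        ring
    _ ≤ ∑ q, P.real (E q) := Finset.sum_le_sum fun q _ => hEP q
    _ = ∫ x, ∑ q, (E q).indicator (fun _ => (1 : ℝ)) x ∂P := by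
        rw [integral_finsetSum _ fun q _ => (integrable_const _).indicator (hEm q)]
        refine Finset.sum_congr rfl fun q _ => ?_
        rw [integral_indicator_const _ (hEm q), smul_eq_mul, mul_one]
    _ ≤ _ := integral_mono
        (integrable_finsetSum _ fun q _ => (integrable_const _).indicator (hEm q)) hcount hpt

end Probability

section Main

lemma exists_pos_forall_ofReal_le_volume {d k : ℕ} {U : Fin k → Set (Euc d)}
    (hU : ∀ i, IsOpen (U i)) (hne : ∀ i, (U i).Nonempty) :
    ∃ m : ℝ, 0 < m ∧ ∀ i, ENNReal.ofReal m ≤ volume (U i) := by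
  have h : ∀ i, ∃ m : ℝ, 0 < m ∧ ENNReal.ofReal m ≤ volume (U i) := by
    intro i
    obtain ⟨c, hc0, hc⟩ := ENNReal.lt_iff_exists_nnreal_btwn.1 ((hU i).measure_pos volume (hne i))
    exact ⟨c, by exact_mod_cast hc0, by simpa using hc.le⟩
  choose m hm0 hm using h
  rcases isEmpty_or_nonempty (Fin k) with he | he
  · exact ⟨1, one_pos, fun i => he.elim i⟩
  · obtain ⟨i, hi⟩ := Finite.exists_min m
    exact ⟨m i, hm0 i, fun l => (ENNReal.ofReal_le_ofReal (hi l)).trans (hm l)⟩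

lemma half_pow_div_factorial_le_choose {n k : ℕ} (h : 2 * k ≤ n) :
    ((n : ℝ) / 2) ^ k / k.factorial ≤ n.choose k := by
  refine le_trans ?_ (Nat.pow_le_choose k n)
  gcongr
  rw [Nat.cast_sub (by omega)]
  have : (2 : ℝ) * k ≤ n := by exact_mod_cast h
  push_cast
  linarith

/-- Squeezed copies of a template with distinct integer heights at the base points differ. -/
lemma disjoint_image_squeeze {d n : ℕ} (hn : 0 < n) (z : Fin d) {r M : ℝ} (hM : 4 * r < M)
    {U : Set (Euc d)} (hUr : U ⊆ cube d r) {v v' : Fin d → Fin n} (hv : v ≠ v')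
    (hM0 : 0 < M)
    (hU : ∀ x ∈ U, ∀ j, |M * (v j : ℝ) / n - M * (v' j : ℝ) / n| / 2 ≤
      |interp z ((fun j => M * (v j : ℝ) / n) - fun j => M * (v' j : ℝ) / n) x|) :
    Disjoint (squeeze z (1 / n) (fun j => M * (v j : ℝ) / n) '' U)
      (squeeze z (1 / n) (fun j => M * (v' j : ℝ) / n) '' U) := by
  have hn' : (0 : ℝ) < n := by exact_mod_cast hn
  rw [Set.disjoint_left]
  rintro _ ⟨x, hx, rfl⟩ ⟨y, hy, hxy⟩
  have hcoord : ∀ j, squeeze z (1 / n) (fun j => M * (v' j : ℝ) / n) y j =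
      squeeze z (1 / n) (fun j => M * (v j : ℝ) / n) x j := fun j => by rw [hxy]
  have hne : ∀ j ≠ z, y j = x j := by
    intro j hj
    simpa only [squeeze_apply_of_ne hj] using hcoord j
  have hz := hcoord z
  rw [squeeze_apply_self, squeeze_apply_self, interp_congr z _ hne] at hz
  obtain ⟨j, hj⟩ := Function.ne_iff.1 hv
  have h1 := hU x hx j
  rw [interp_sub] at h1
  have h2 : interp z (fun j => M * (v j : ℝ) / n) x - interp z (fun j => M * (v' j : ℝ) / n) x =
      1 / n * (y z - x z) := by linarith
  have h3 : |y z - x z| ≤ 2 * r := by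
    have := abs_sub (y z) (x z)
    linarith [hUr hx z, hUr hy z]
  have h4 : M * (v j : ℝ) / n - M * (v' j : ℝ) / n = 1 / n * (M * ((v j : ℝ) - v' j)) := by ring
  have h5 : (1 : ℝ) ≤ |(v j : ℝ) - v' j| := by
    have h6 : (1 : ℤ) ≤ |(v j : ℤ) - v' j| := by
      refine Int.one_le_abs (sub_ne_zero.2 fun h => hj (Fin.ext (by exact_mod_cast h)))
    exact_mod_cast h6
  rw [h2, h4, abs_mul, abs_mul, abs_mul, abs_of_pos (by positivity : (0 : ℝ) < 1 / n),
    abs_of_pos hM0, mul_div_assoc] at h1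
  have h6 := le_of_mul_le_mul_left h1 (by positivity)
  nlinarith

end Main

/-- For all integers `d ≥ 2` and `k ≥ d+1`, there are `C = C(d,k) > 0` and
`n₀ = n₀(d,k)` such that for every `n ≥ n₀` and every convex body `K ⊆ ℝ^d` of
unit volume, `EH^K_{d,k}(n) ≥ C · n^d`. -/
theorem statement0 (d k : ℕ) (hd : 2 ≤ d) (hk : d + 1 ≤ k) :
    ∃ C : ℝ, 0 < C ∧ ∃ n₀ : ℕ, ∀ n : ℕ, n₀ ≤ n →
      ∀ K : Set (Euc d), IsConvexBody K → volume K = 1 →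
        C * (n : ℝ) ^ d ≤ EH d k K n := by
  obtain ⟨z, r, U, hr, hUo, hUne, hUr, hUpos, hUinterp⟩ :=
    exists_template (k := k) hd (by omega)
  obtain ⟨m, hm0, hm⟩ := exists_pos_forall_ofReal_le_volume hUo hUne
  have hd' : (0 : ℝ) < d := by exact_mod_cast (by omega : 0 < d)
  set M : ℝ := 4 * r + 1 with hM
  have hM0 : 0 < M := by positivity
  set R : ℝ := 2 * r + (M + d * (2 * M * r)) with hR
  have hR0 : 0 < R := by positivity
  have hRr : 2 * r ≤ R := by
    have : 0 ≤ M + d * (2 * M * r) := by positivity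
    linarith
  set κ : ℝ := ((4 * d * R) ^ d)⁻¹ with hκ
  have hκ0 : 0 < κ := by positivity
  refine ⟨(κ * m) ^ k / (2 ^ (k + 1) * k.factorial), by positivity, 2 * k, fun n hn K hK hvol => ?_⟩
  have hn0 : 0 < n := by omega
  have hn' : (0 : ℝ) < n := by exact_mod_cast hn0
  have hn1 : (1 : ℝ) ≤ n := by exact_mod_cast hn0
  have hinv : 1 / (n : ℝ) ≤ 1 := (div_le_one hn').2 hn1
  obtain ⟨A, hAdet, hAK⟩ := exists_affineMap_image_cube_subset (by omega : 0 < d) hR0 hK hvol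
  let a : (Fin d → Fin n) → Fin d → ℝ := fun v j => M * (v j : ℝ) / n
  have ha : ∀ v j, |a v j| ≤ M := by
    intro v j
    have hv : ((v j : ℕ) : ℝ) ≤ n := by exact_mod_cast (v j).2.le
    rw [abs_of_nonneg (by positivity), div_le_iff₀ hn']
    exact mul_le_mul_of_nonneg_left hv hM0.le
  let T : (Fin d → Fin n) → Euc d →ᵃ[ℝ] Euc d := fun v => A.comp (squeeze z (1 / n) (a v))
  have hTdet : ∀ v, |LinearMap.det (T v).linear| = |LinearMap.det A.linear| * (1 / n) := by
    intro v
    have : (T v).linear = A.linear ∘ₗ (squeeze z (1 / n) (a v)).linear := rfl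
    rw [this, LinearMap.det_comp, det_linear_squeeze, abs_mul,
      abs_of_pos (by positivity : (0 : ℝ) < 1 / n)]
  have hA0 : 0 < |LinearMap.det A.linear| := hκ0.trans_le hAdet
  have hAinj : Function.Injective A := injective_of_det_linear_ne_zero (abs_pos.1 hA0)
  have hTinj : ∀ v, Function.Injective (T v) := fun v =>
    injective_of_det_linear_ne_zero (abs_pos.1 (by rw [hTdet]; positivity))
  have hTm : ∀ v (s : Set (Euc d)), MeasurableSet s → MeasurableSet (T v '' s) := fun v s hs =>
    hs.image_of_continuousOn_injOn (T v).continuous_of_finiteDimensional.continuousOn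
      (hTinj v).injOn
  have hAvol : |LinearMap.det A.linear| * (2 * R) ^ d ≤ 1 := by
    have h1 := measure_mono (μ := volume) hAK
    rwa [volume_image_affineMap, volume_cube d hR0.le, ← ENNReal.ofReal_mul (abs_nonneg _), hvol,
      ENNReal.ofReal_le_one] at h1
  have hmain := le_EH_of_regions (n := n) (w := κ * m * (1 / n)) (ε := 1 / 2 * (1 / n))
    (W := fun v i => T v '' U i) (D := fun v => T v '' cube d r) (by omega : 2 ≤ k)
    hK.2.1.measurableSet hvol (by positivity) (by field_simp; rfl) (by positivity)
    (by linarith) (fun v i => hTm v _ (hUo i).measurableSet)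
    (fun v => hTm v _ (measurableSet_cube d r)) (fun v i => Set.image_mono (hUr i)) ?_
    (fun v => (convex_cube d r).affine_image (T v)) ?_ ?_ ?_ ?_
  · refine le_trans ?_ hmain
    rw [Fintype.card_fun, Fintype.card_fin, Fintype.card_fin]
    push_cast
    calc (κ * m) ^ k / (2 ^ (k + 1) * k.factorial) * (n : ℝ) ^ d
        = ((n : ℝ) / 2) ^ k / k.factorial * n ^ d * ((κ * m * (1 / n)) ^ k / 2) := by
          rw [mul_pow _ (1 / (n : ℝ)), div_pow, div_pow]
          field_simp
          ring
      _ ≤ _ := by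
          gcongr
          exact half_pow_div_factorial_le_choose hn
  · rintro v _ ⟨x, hx, rfl⟩
    refine hAK ⟨_, fun j => ?_, rfl⟩
    have := squeeze_mem_cube z (by positivity) hinv (ha v) hr.le hx j
    linarith
  · intro v u hu i hmem
    choose y hyU hy using hu
    have himg : u '' {i}ᶜ = T v '' (y '' {i}ᶜ) := by
      rw [Set.image_image]
      exact Set.image_congr fun l _ => (hy l).symm
    rw [himg, ← AffineMap.image_convexHull, ← hy i, (hTinj v).mem_set_image] at hmem
    exact hUpos y hyU i hmem
  · intro v v' hv
    obtain ⟨i, hi⟩ := hUinterp (a v - a v')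
    refine ⟨i, ?_⟩
    have := disjoint_image_squeeze hn0 z (by linarith : 4 * r < M) (hUr i) hv hM0 hi
    simp only [T, AffineMap.coe_comp, Set.image_comp]
    exact (Set.disjoint_image_iff hAinj).2 this
  · intro v i
    rw [volume_image_affineMap, hTdet]
    calc ENNReal.ofReal (κ * m * (1 / n))
        = ENNReal.ofReal (κ * (1 / n)) * ENNReal.ofReal m := by
          rw [← ENNReal.ofReal_mul (by positivity)]
          ring_nf
      _ ≤ _ := by gcongr; exact hm i
  · intro v
    rw [volume_image_affineMap, hTdet, volume_cube d hr.le, ← ENNReal.ofReal_mul (by positivity)]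
    refine ENNReal.ofReal_le_ofReal ?_
    have h1 : 2 * (2 * r) ^ d ≤ (2 * R) ^ d :=
      calc 2 * (2 * r) ^ d ≤ 2 ^ d * (2 * r) ^ d := by
            gcongr
            exact le_self_pow₀ one_le_two (by omega)
        _ = (2 * (2 * r)) ^ d := (mul_pow _ _ _).symm
        _ ≤ (2 * R) ^ d := by gcongr
    have h2 : |LinearMap.det A.linear| * (2 * r) ^ d ≤ 1 / 2 := by nlinarith
    calc |LinearMap.det A.linear| * (1 / n) * (2 * r) ^ d
        = |LinearMap.det A.linear| * (2 * r) ^ d * (1 / n) := by ring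
      _ ≤ 1 / 2 * (1 / n) := by gcongr
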